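/- Let X^(La)_n be the lazy random walk on ℤ with final time n and parameter r(n) ∼ r/n^α, where 0 < r < 1 and α ≥ 0. Then as n → ∞: if 0 ≤ α < 1, then X^(La)_n/√(n^{1−α}) converges weakly to N(0, r); if α = 1, then P(X^(La)_n = x) → e^{−r} I_x(r) for each x ∈ ℤ; and if α > 1, then P(X^(La)_n = x) → δ_0(x) for each x ∈ ℤ. -/

import Mathlib

open MeasureTheory Filter Real Topology

noncomputable section

/-- Distribution `p_m(x)` of the lazy random walk on ℤ with movement probability `ρ`:
`p_m(x) = (1−ρ)p_{m−1}(x) + (ρ/2)(p_{m−1}(x−1) + p_{m−1}(x+1))`, `p_0(x) = δ_0(x)`. -/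
def lazyDist (ρ : ℝ) : ℕ → ℤ → ℝ
  | 0 => fun x => if x = 0 then 1 else 0
  | m + 1 => fun x =>
      (1 - ρ) * lazyDist ρ m x + (ρ / 2) * (lazyDist ρ m (x - 1) + lazyDist ρ m (x + 1))

/-- Modified Bessel function of integer order `n` (integral representation). -/
def besselI (n : ℤ) (t : ℝ) : ℝ :=
  (1 / π) * ∫ θ in (0 : ℝ)..π, Real.exp (t * Real.cos θ) * Real.cos (n * θ)

/-- Density of the normal distribution `N(0, v)`. -/
def normalPDF (v x : ℝ) : ℝ := (Real.sqrt (2 * π * v))⁻¹ * Real.exp (-(x ^ 2) / (2 * v))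

/-- One-step multiplier bound. -/
lemma abs_mult_le {ρ : ℝ} (h0 : 0 < ρ) (h1 : ρ < 1) (θ : ℝ) :
    |1 + -(ρ * (1 - Real.cos θ))| ≤ 1 := by
  have a := Real.cos_le_one θ
  have b := Real.neg_one_le_cos θ
  rw [abs_le]
  constructor <;> nlinarith

lemma integral_cos_int (x : ℤ) :
    ∫ θ in (0 : ℝ)..π, Real.cos (x * θ) = if x = 0 then π else 0 := by
  split_ifs with h
  · simp [h]
  · have hx : (x : ℝ) ≠ 0 := by exact_mod_cast h
    rw [intervalIntegral.integral_comp_mul_left (fun u => Real.cos u) hx]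
    simp

/-- Fourier inversion formula for the lazy walk. -/
lemma lazyDist_eq_integral (ρ : ℝ) (m : ℕ) (x : ℤ) :
    lazyDist ρ m x = (1 / π) * ∫ θ in (0 : ℝ)..π,
      (1 + -(ρ * (1 - Real.cos θ))) ^ m * Real.cos (x * θ) := by
  induction m generalizing x with
  | zero =>
    simp only [lazyDist, pow_zero, one_mul, integral_cos_int]
    split_ifs
    · field_simp
    · simp
  | succ m ih =>
    have hi : ∀ y : ℤ, IntervalIntegrable (fun θ : ℝ =>
        (1 + -(ρ * (1 - Real.cos θ))) ^ m * Real.cos (y * θ)) volume 0 π := fun y =>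
      Continuous.intervalIntegrable (by fun_prop) _ _
    simp only [lazyDist]
    rw [ih, ih, ih]
    have : (∫ θ in (0 : ℝ)..π, (1 + -(ρ * (1 - Real.cos θ))) ^ (m + 1) * Real.cos (x * θ)) =
        ∫ θ in (0 : ℝ)..π, ((1 - ρ) * ((1 + -(ρ * (1 - Real.cos θ))) ^ m * Real.cos (x * θ))
          + (ρ / 2) * ((1 + -(ρ * (1 - Real.cos θ))) ^ m * Real.cos ((x - 1 : ℤ) * θ)
            + (1 + -(ρ * (1 - Real.cos θ))) ^ m * Real.cos ((x + 1 : ℤ) * θ))) := by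
      apply intervalIntegral.integral_congr
      intro θ _
      have e1 : ((x - 1 : ℤ) : ℝ) * θ = x * θ - θ := by push_cast; ring
      have e2 : ((x + 1 : ℤ) : ℝ) * θ = x * θ + θ := by push_cast; ring
      simp only [e1, e2, Real.cos_add, Real.cos_sub]
      ring
    rw [this, intervalIntegral.integral_add ((hi x).const_mul _)
      (((hi _).add (hi _)).const_mul _), intervalIntegral.integral_const_mul,
      intervalIntegral.integral_const_mul, intervalIntegral.integral_add (hi _) (hi _)]
    ring

/-- Poisson-type regime: `n * r(n) → c`. -/
lemma lazy_poisson {rs : ℕ → ℝ} (hrs : ∀ n, rs n ∈ Set.Ioo (0 : ℝ) 1) {c : ℝ}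
    (h : Tendsto (fun n : ℕ => (n : ℝ) * rs n) atTop (𝓝 c)) (x : ℤ) :
    Tendsto (fun n : ℕ => lazyDist (rs n) n x) atTop (𝓝 (Real.exp (-c) * besselI x c)) := by
  have key : Tendsto (fun n : ℕ => ∫ θ in (0 : ℝ)..π,
      (1 + -(rs n * (1 - Real.cos θ))) ^ n * Real.cos (x * θ)) atTop
      (𝓝 (∫ θ in (0 : ℝ)..π, Real.exp (-(c * (1 - Real.cos θ))) * Real.cos (x * θ))) := by
    apply intervalIntegral.tendsto_integral_filter_of_dominated_convergence (fun _ => (1 : ℝ))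
    · exact Eventually.of_forall fun n => Continuous.aestronglyMeasurable (by fun_prop)
    · refine Eventually.of_forall fun n => ae_of_all _ fun θ _ => ?_
      rw [norm_mul, norm_pow, Real.norm_eq_abs, Real.norm_eq_abs]
      exact mul_le_one₀ (pow_le_one₀ (abs_nonneg _) (abs_mult_le (hrs n).1 (hrs n).2 θ))
        (abs_nonneg _) (Real.abs_cos_le_one _)
    · simp
    · refine ae_of_all _ fun θ _ => Tendsto.mul_const _ ?_
      apply Real.tendsto_one_add_pow_exp_of_tendsto
      refine ((h.mul_const (1 - Real.cos θ)).neg).congr fun n => ?_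
      ring
  have e : Real.exp (-c) * besselI x c = (1 / π) *
      ∫ θ in (0 : ℝ)..π, Real.exp (-(c * (1 - Real.cos θ))) * Real.cos (x * θ) := by
    unfold besselI
    rw [mul_left_comm, ← intervalIntegral.integral_const_mul]
    congr 1
    apply intervalIntegral.integral_congr
    intro θ _
    simp only
    rw [← mul_assoc, ← Real.exp_add]
    congr 2
    ring
  rw [e]
  simp_rw [lazyDist_eq_integral]
  exact key.const_mul _

/-- The law of the lazy walk as a measure on `ℤ`. -/
def lazyMeas (ρ : ℝ) : ℕ → Measure ℤ
  | 0 => Measure.dirac 0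
  | m + 1 => ENNReal.ofReal (1 - ρ) • lazyMeas ρ m + ENNReal.ofReal (ρ / 2) •
      ((lazyMeas ρ m).map (fun x => x + 1) + (lazyMeas ρ m).map (fun x => x - 1))

lemma lazyMeas_prob {ρ : ℝ} (h0 : 0 < ρ) (h1 : ρ < 1) (m : ℕ) :
    IsProbabilityMeasure (lazyMeas ρ m) := by
  induction m with
  | zero => simp only [lazyMeas]; infer_instance
  | succ m ih =>
    constructor
    simp only [lazyMeas, Measure.add_apply, Measure.smul_apply, smul_eq_mul]
    rw [Measure.map_apply (by fun_prop) MeasurableSet.univ,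
      Measure.map_apply (by fun_prop) MeasurableSet.univ]
    simp only [Set.preimage_univ, measure_univ, mul_one]
    rw [one_add_one_eq_two, ← ENNReal.ofReal_ofNat, ← ENNReal.ofReal_mul (by linarith),
      ← ENNReal.ofReal_add (by linarith) (by linarith)]
    simp

lemma lazyDist_nonneg {ρ : ℝ} (h0 : 0 < ρ) (h1 : ρ < 1) (m : ℕ) (x : ℤ) :
    0 ≤ lazyDist ρ m x := by
  induction m generalizing x with
  | zero => simp only [lazyDist]; split_ifs <;> norm_num
  | succ m ih =>
    simp only [lazyDist]
    have := ih x
    have := ih (x - 1)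
    have := ih (x + 1)
    have : 0 ≤ 1 - ρ := by linarith
    positivity

lemma lazyMeas_singleton {ρ : ℝ} (h0 : 0 < ρ) (h1 : ρ < 1) (m : ℕ) (x : ℤ) :
    lazyMeas ρ m {x} = ENNReal.ofReal (lazyDist ρ m x) := by
  induction m generalizing x with
  | zero =>
    simp only [lazyDist, lazyMeas]
    rw [Measure.dirac_apply' _ (measurableSet_singleton x)]
    by_cases h : x = 0
    · simp [h]
    · simp [h, Ne.symm h]
  | succ m ih =>
    have a := lazyDist_nonneg h0 h1 m
    simp only [lazyMeas, lazyDist, Measure.add_apply, Measure.smul_apply, smul_eq_mul]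
    rw [Measure.map_apply (by fun_prop) (measurableSet_singleton x),
      Measure.map_apply (by fun_prop) (measurableSet_singleton x)]
    have e1 : (fun y : ℤ => y + 1) ⁻¹' {x} = {x - 1} := by
      ext y; simp only [Set.mem_preimage, Set.mem_singleton_iff]; omega
    have e2 : (fun y : ℤ => y - 1) ⁻¹' {x} = {x + 1} := by
      ext y; simp only [Set.mem_preimage, Set.mem_singleton_iff]; omega
    rw [e1, e2, ih, ih, ih, ← ENNReal.ofReal_add (a _) (a _), ← ENNReal.ofReal_mul (by linarith),
      ← ENNReal.ofReal_mul (by linarith), ← ENNReal.ofReal_add]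
    · exact mul_nonneg (by linarith) (a _)
    · exact mul_nonneg (by linarith) (add_nonneg (a _) (a _))

lemma lazyMeas_fourier {ρ : ℝ} (h0 : 0 < ρ) (h1 : ρ < 1) (m : ℕ) (θ : ℝ) :
    ∫ x : ℤ, Complex.exp (θ * x * Complex.I) ∂(lazyMeas ρ m) =
      (((1 + -(ρ * (1 - Real.cos θ))) ^ m : ℝ) : ℂ) := by
  induction m with
  | zero => simp [lazyMeas]
  | succ m ih =>
    have := lazyMeas_prob h0 h1 m
    have hi : ∀ (μ : Measure ℤ) [IsFiniteMeasure μ],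
        Integrable (fun x : ℤ => Complex.exp (θ * x * Complex.I)) μ := by
      intro μ _
      refine Integrable.of_bound (C := 1) (measurable_of_countable _).aestronglyMeasurable
        (ae_of_all _ fun x => ?_)
      have := Complex.norm_exp_ofReal_mul_I (θ * x)
      push_cast at this
      exact this.le
    have hp : IsFiniteMeasure ((lazyMeas ρ m).map (fun x => x + 1)) := inferInstance
    have hm : IsFiniteMeasure ((lazyMeas ρ m).map (fun x => x - 1)) := inferInstance
    simp only [lazyMeas]
    rw [integral_add_measure ((hi _).smul_measure ENNReal.ofReal_ne_top)
      ((hi _).smul_measure ENNReal.ofReal_ne_top), integral_smul_measure, integral_smul_measure,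
      integral_add_measure (hi _) (hi _),
      integral_map (by fun_prop) (measurable_of_countable _).aestronglyMeasurable,
      integral_map (by fun_prop) (measurable_of_countable _).aestronglyMeasurable]
    have e1 : ∀ x : ℤ, Complex.exp (θ * ((x + 1 : ℤ) : ℂ) * Complex.I) =
        Complex.exp (θ * Complex.I) * Complex.exp (θ * x * Complex.I) := by
      intro x; rw [← Complex.exp_add]; congr 1; push_cast; ring
    have e2 : ∀ x : ℤ, Complex.exp (θ * ((x - 1 : ℤ) : ℂ) * Complex.I) =
        Complex.exp (-θ * Complex.I) * Complex.exp (θ * x * Complex.I) := by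
      intro x; rw [← Complex.exp_add]; congr 1; push_cast; ring
    simp_rw [e1, e2]
    rw [integral_const_mul, integral_const_mul, ih, ENNReal.toReal_ofReal (by linarith),
      ENNReal.toReal_ofReal (by linarith), Complex.real_smul, Complex.real_smul]
    have := Complex.two_cos (θ : ℂ)
    rw [← add_mul, ← this]
    push_cast
    ring

/-- The rescaled law on `ℝ`. -/
def scaledMeas (ρ s : ℝ) (m : ℕ) : Measure ℝ := (lazyMeas ρ m).map (fun x : ℤ => (x : ℝ) / s)

lemma scaledMeas_prob {ρ : ℝ} (h0 : 0 < ρ) (h1 : ρ < 1) (s : ℝ) (m : ℕ) :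
    IsProbabilityMeasure (scaledMeas ρ s m) := by
  have := lazyMeas_prob h0 h1 m
  exact Measure.isProbabilityMeasure_map (measurable_of_countable _).aemeasurable

lemma scaledMeas_charFun {ρ : ℝ} (h0 : 0 < ρ) (h1 : ρ < 1) (s : ℝ) (m : ℕ) (t : ℝ) :
    charFun (scaledMeas ρ s m) t = (((1 + -(ρ * (1 - Real.cos (t / s)))) ^ m : ℝ) : ℂ) := by
  rw [charFun_apply_real, scaledMeas, integral_map (measurable_of_countable _).aemeasurable
    (by fun_prop), ← lazyMeas_fourier h0 h1]
  congr 1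
  ext x
  congr 1
  push_cast
  ring

lemma scaledMeas_Iic {ρ : ℝ} (h0 : 0 < ρ) (h1 : ρ < 1) (s : ℝ) (m : ℕ) (y : ℝ) :
    (scaledMeas ρ s m (Set.Iic y)).toReal =
      ∑' x : ℤ, if (x : ℝ) / s ≤ y then lazyDist ρ m x else 0 := by
  have := lazyMeas_prob h0 h1 m
  rw [scaledMeas, Measure.map_apply (measurable_of_countable _) measurableSet_Iic,
    ← Measure.tsum_indicator_apply_singleton _ _ (MeasurableSet.of_discrete),
    ENNReal.tsum_toReal_eq]
  · congr 1
    ext x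
    by_cases hx : (x : ℝ) / s ≤ y
    · rw [Set.indicator_of_mem (by exact hx), if_pos hx, lazyMeas_singleton h0 h1,
        ENNReal.toReal_ofReal (lazyDist_nonneg h0 h1 m x)]
    · rw [Set.indicator_of_notMem (by exact hx), if_neg hx]
      simp
  · intro x
    by_cases hx : (x : ℝ) / s ≤ y
    · rw [Set.indicator_of_mem (by exact hx)]
      exact measure_ne_top _ _
    · rw [Set.indicator_of_notMem (by exact hx)]
      simp

lemma cos_scaling (t : ℝ) {s : ℕ → ℝ} (hs : Tendsto s atTop atTop) :
    Tendsto (fun n => s n ^ 2 * (1 - Real.cos (t / s n))) atTop (𝓝 (t ^ 2 / 2)) := by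
  have h1 : Tendsto (fun n => t / s n / 2) atTop (𝓝 0) := by
    simpa using (hs.const_div_atTop t).div_const 2
  have h2 := (Real.continuous_sinc.tendsto 0).comp h1
  rw [Real.sinc_zero] at h2
  have h3 := (h2.pow 2).const_mul (t ^ 2 / 2)
  simp only [one_pow, mul_one] at h3
  refine h3.congr' ?_
  filter_upwards [hs.eventually_gt_atTop 0] with n hn
  have hc : Real.cos (t / s n) = 1 - 2 * Real.sin (t / s n / 2) ^ 2 := by
    have := Real.cos_two_mul (t / s n / 2)
    rw [Real.cos_sq', show 2 * (t / s n / 2) = t / s n by ring] at this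
    rw [this]; ring
  rw [hc]
  simp only [Function.comp]
  by_cases ht : t = 0
  · simp [ht]
  · rw [Real.sinc_of_ne_zero (by positivity)]
    field_simp
    ring

/-- Gaussian regime. -/
lemma lazy_gauss {rs : ℕ → ℝ} (hrs : ∀ n, rs n ∈ Set.Ioo (0 : ℝ) 1) {r : ℝ} (hr : 0 < r)
    {s : ℕ → ℝ} (hs : Tendsto s atTop atTop)
    (h : Tendsto (fun n : ℕ => (n : ℝ) * rs n / s n ^ 2) atTop (𝓝 r)) (y : ℝ) :
    Tendsto (fun n : ℕ => ∑' x : ℤ, if (x : ℝ) / s n ≤ y then lazyDist (rs n) n x else 0)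
      atTop (𝓝 (∫ u in Set.Iio y, normalPDF r u)) := by
  let v : NNReal := ⟨r, hr.le⟩
  have hv : v ≠ 0 := fun h => hr.ne' (congrArg NNReal.toReal h)
  let μ : ℕ → ProbabilityMeasure ℝ := fun n =>
    ⟨scaledMeas (rs n) (s n) n, scaledMeas_prob (hrs n).1 (hrs n).2 _ _⟩
  let μ₀ : ProbabilityMeasure ℝ := ⟨ProbabilityTheory.gaussianReal 0 v, inferInstance⟩
  have hconv : Tendsto μ atTop (𝓝 μ₀) := by
    rw [ProbabilityMeasure.tendsto_iff_tendsto_charFun]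
    intro t
    have e : charFun (μ₀ : Measure ℝ) t = ((Real.exp (-(r * (t ^ 2 / 2))) : ℝ) : ℂ) := by
      change charFun (ProbabilityTheory.gaussianReal 0 v) t = _
      rw [ProbabilityTheory.charFun_gaussianReal]
      have : ((v : ℝ) : ℂ) = (r : ℂ) := rfl
      rw [this]
      push_cast
      congr 1
      ring
    rw [e]
    have e' : ∀ n, charFun (μ n : Measure ℝ) t = _ := fun n =>
      scaledMeas_charFun (hrs n).1 (hrs n).2 (s n) n t
    simp_rw [e']
    refine (Complex.continuous_ofReal.tendsto _).comp ?_
    apply Real.tendsto_one_add_pow_exp_of_tendsto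
    refine (h.mul (cos_scaling t hs)).neg.congr' ?_
    filter_upwards [hs.eventually_gt_atTop 0] with n hn
    field_simp
  have hfr : (μ₀ : Measure ℝ) (frontier (Set.Iic y)) = 0 := by
    rw [frontier_Iic]
    have := ProbabilityTheory.nullSingletonClass_gaussianReal (μ := 0) hv
    exact measure_singleton (μ := ProbabilityTheory.gaussianReal 0 v) y
  have hl := ProbabilityMeasure.tendsto_measure_of_null_frontier_of_tendsto' hconv hfr
  have hl2 := (ENNReal.tendsto_toReal (measure_ne_top _ _)).comp hl
  have e : ((μ₀ : Measure ℝ) (Set.Iic y)).toReal = ∫ u in Set.Iio y, normalPDF r u := by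
    change (ProbabilityTheory.gaussianReal 0 v (Set.Iic y)).toReal = _
    rw [ProbabilityTheory.gaussianReal_apply_eq_integral _ hv, ENNReal.toReal_ofReal
      (integral_nonneg fun u => ProbabilityTheory.gaussianPDFReal_nonneg _ _ _),
      integral_Iic_eq_integral_Iio]
    congr 1
    ext u
    simp only [ProbabilityTheory.gaussianPDFReal, normalPDF, sub_zero]
    rfl
  rw [e] at hl2
  exact hl2.congr fun n => scaledMeas_Iic (hrs n).1 (hrs n).2 (s n) n y

/-- **Crossover for the lazy random walk.** If `r(n) ∼ r/n^α` with `0 < r < 1`, `α ≥ 0`,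
then as `n → ∞`: for `0 ≤ α < 1`, `X^(La)_n/√(n^{1−α}) ⇒ N(0, r)`; for `α = 1`,
`P(X^(La)_n = x) → e^{−r} I_x(r)`; for `α > 1`, `P(X^(La)_n = x) → δ_0(x)`. -/
theorem lazy_rw_crossover
    (r : ℝ) (hr0 : 0 < r) (hr1 : r < 1)
    (α : ℝ) (hα : 0 ≤ α)
    (rs : ℕ → ℝ) (hrs : ∀ n, rs n ∈ Set.Ioo (0 : ℝ) 1)
    (hsim : Tendsto (fun n : ℕ => rs n / (r / (n : ℝ) ^ α)) atTop (𝓝 1)) :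
    (α < 1 → ∀ y : ℝ, Tendsto
        (fun n : ℕ => ∑' x : ℤ,
          if (x : ℝ) / Real.sqrt ((n : ℝ) ^ ((1 : ℝ) - α)) ≤ y then lazyDist (rs n) n x else 0)
        atTop (𝓝 (∫ u in Set.Iio y, normalPDF r u))) ∧
    (α = 1 → ∀ x : ℤ, Tendsto (fun n : ℕ => lazyDist (rs n) n x)
        atTop (𝓝 (Real.exp (-r) * besselI x r))) ∧
    (1 < α → ∀ x : ℤ, Tendsto (fun n : ℕ => lazyDist (rs n) n x)
        atTop (𝓝 (if x = 0 then 1 else 0))) := by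
  have hlim : Tendsto (fun n : ℕ => (n : ℝ) * rs n / (n : ℝ) ^ ((1 : ℝ) - α)) atTop (𝓝 r) := by
    have := hsim.mul_const r
    rw [one_mul] at this
    refine this.congr' ?_
    filter_upwards [eventually_gt_atTop 0] with n hn
    have hn' : (0 : ℝ) < n := by exact_mod_cast hn
    have := Real.rpow_pos_of_pos hn' α
    rw [Real.rpow_sub hn', Real.rpow_one]
    field_simp
  refine ⟨fun h1 y => ?_, fun h1 x => ?_, fun h1 x => ?_⟩
  · have hs : Tendsto (fun n : ℕ => Real.sqrt ((n : ℝ) ^ ((1 : ℝ) - α))) atTop atTop :=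
      Real.tendsto_sqrt_atTop.comp
        ((tendsto_rpow_atTop (by linarith)).comp tendsto_natCast_atTop_atTop)
    refine lazy_gauss hrs hr0 hs (hlim.congr fun n => ?_) y
    rw [Real.sq_sqrt (by positivity)]
  · refine lazy_poisson hrs (hlim.congr fun n => ?_) x
    simp [h1]
  · have h0 : Tendsto (fun n : ℕ => (n : ℝ) * rs n) atTop (𝓝 0) := by
      have hp : Tendsto (fun n : ℕ => (n : ℝ) ^ ((1 : ℝ) - α)) atTop (𝓝 0) := by
        have := (tendsto_rpow_neg_atTop (y := α - 1) (by linarith)).comp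
          (tendsto_natCast_atTop_atTop (R := ℝ))
        rw [neg_sub] at this
        exact this
      have := hlim.mul hp
      rw [mul_zero] at this
      refine this.congr' ?_
      filter_upwards [eventually_gt_atTop 0] with n hn
      have hn' : (0 : ℝ) < n := by exact_mod_cast hn
      exact div_mul_cancel₀ _ (Real.rpow_pos_of_pos hn' _).ne'
    have := lazy_poisson hrs h0 x
    have e : Real.exp (-0) * besselI x 0 = if x = 0 then 1 else 0 := by
      simp only [besselI, zero_mul, Real.exp_zero, one_mul, integral_cos_int, neg_zero]
      split_ifs
      · field_simp
      · simp
    rw [e] at this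
    exact this
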